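/- Let p ∈ (1,∞] and suppose that every x₀ ∈ C^{0,1−1/p} admits a solution of ẋ(t) = f(x_t) on [0,∞) (write φ(t,x₀) := x_t). Then, for X = W^{1,p} and also for X = C^{0,1−1/p}, the system is robustly forward complete on X: for every x₀ ∈ X and t ≥ 0 the segment φ(t,x₀) belongs to X, and for every ρ, T > 0 one has sup{‖φ(t,x₀)‖_X : t ∈ [0,T], x₀ ∈ X, ‖x₀‖_X ≤ ρ} < ∞. -/

import Mathlib

open Set MeasureTheory Filter Topology
open scoped ENNReal NNReal

noncomputable section

abbrev Vec (n : ℕ) := EuclideanSpace ℝ (Fin n)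

variable {n : ℕ}

/-- The segment `x_t` of a history `x : ℝ → ℝⁿ`, i.e. `x_t(s) = x(t+s)`
(only its values on `[-r,0]` are relevant). -/
def seg (r : ℝ) (x : ℝ → Vec n) (t : ℝ) : ℝ → Vec n := fun s => x (t + s)

/-- Sup norm over `[-r,0]`. -/
def supN (r : ℝ) (g : ℝ → Vec n) : ℝ := sSup ((fun s => ‖g s‖) '' Icc (-r) 0)

/-- Membership in `C⁰ = C([-r,0];ℝⁿ)`. -/
def MemC0 (r : ℝ) (g : ℝ → Vec n) : Prop := ContinuousOn g (Icc (-r) 0)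

/-- `f` vanishes at `0`, depends only on the values of its argument on `[-r,0]`,
and is Lipschitz on bounded subsets of `C⁰` with a nondecreasing (nonnegative)
modulus `L`. -/
def GoodRHS (r : ℝ) (f : (ℝ → Vec n) → Vec n) (L : ℝ → ℝ) : Prop :=
  f 0 = 0 ∧
  (∀ x y : ℝ → Vec n, EqOn x y (Icc (-r) 0) → f x = f y) ∧
  Monotone L ∧ (∀ s : ℝ, 0 ≤ L s) ∧
  ∀ R : ℝ, ∀ x y : ℝ → Vec n, MemC0 r x → MemC0 r y → supN r x ≤ R → supN r y ≤ R →
    ‖f x - f y‖ ≤ L R * supN r (x - y)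

/-- `x : ℝ → ℝⁿ` is a solution on `[-r, b)` (with `b ∈ (0,∞]` an extended
nonnegative real) of the delay system `ẋ(t) = f(x_t)` with initial condition `x0`:
it is continuous on `[-r,b)`, coincides with `x0` on `[-r,0]`, and satisfies the
integral equation `x(t) = x(0) + ∫₀ᵗ f(x_s) ds` on `[0,b)`. -/
def IsSol (r : ℝ) (f : (ℝ → Vec n) → Vec n) (x0 x : ℝ → Vec n) (b : ℝ≥0∞) : Prop :=
  ContinuousOn x {t : ℝ | -r ≤ t ∧ ENNReal.ofReal t < b} ∧
  EqOn x x0 (Icc (-r) 0) ∧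
  ∀ t : ℝ, 0 ≤ t → ENNReal.ofReal t < b → x t = x 0 + ∫ s in (0:ℝ)..t, f (seg r x s)

/-- Class `KL` functions `σ : [0,∞)×[0,∞) → [0,∞)`. -/
def ClassKL (σ : ℝ → ℝ → ℝ) : Prop :=
  (∀ s t : ℝ, 0 ≤ s → 0 ≤ t → 0 ≤ σ s t) ∧
  (∀ t : ℝ, 0 ≤ t →
    ContinuousOn (fun s => σ s t) (Ici 0) ∧ StrictMonoOn (fun s => σ s t) (Ici 0) ∧
      σ 0 t = 0) ∧
  (∀ s : ℝ, 0 ≤ s →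
    AntitoneOn (fun t => σ s t) (Ici 0) ∧ Tendsto (fun t => σ s t) atTop (nhds 0))

/-- Class `K∞` functions `a : [0,∞) → [0,∞)`. -/
def ClassKInf (a : ℝ → ℝ) : Prop :=
  (∀ s : ℝ, 0 ≤ s → 0 ≤ a s) ∧ ContinuousOn a (Ici 0) ∧ StrictMonoOn a (Ici 0) ∧
  a 0 = 0 ∧ Tendsto a atTop atTop

/-- The set of Hölder difference quotients `‖g t - g s‖ / |t-s|^α` over a set `S`. -/
def hRatios (α : ℝ) (S : Set ℝ) (g : ℝ → Vec n) : Set ℝ :=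
  {c | ∃ t ∈ S, ∃ s ∈ S, t ≠ s ∧ c = ‖g t - g s‖ / |t - s| ^ α}

/-- Membership in the Hölder space `C^{0,α}([-r,0])`. -/
def MemHol (r α : ℝ) (g : ℝ → Vec n) : Prop :=
  MemC0 r g ∧ BddAbove (hRatios α (Icc (-r) 0) g)

/-- The Hölder norm `max(‖g‖_∞, [g]_α)`. -/
def holderNorm (r α : ℝ) (g : ℝ → Vec n) : ℝ :=
  max (supN r g) (sSup (hRatios α (Icc (-r) 0) g))

/-- Membership in the Sobolev space `W^{1,p}([-r,0])`: `g` is absolutely continuous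
on `[-r,0]` (i.e. the integral of an integrable function `d`, which is then its a.e.
derivative) with `d ∈ L^p((-r,0))`. -/
def MemW (r : ℝ) (p : ℝ≥0∞) (g : ℝ → Vec n) : Prop :=
  ∃ d : ℝ → Vec n, IntegrableOn d (Icc (-r) 0) ∧
    eLpNorm d p (volume.restrict (Ioo (-r) 0)) < ⊤ ∧
    ∀ t ∈ Icc (-r) 0, g t = g (-r) + ∫ s in (-r)..t, d s

/-- The Sobolev norm `‖g‖_∞ + ‖ġ‖_p`; for an absolutely continuous `g` the a.e.
derivative coincides a.e. on `(-r,0)` with `deriv g`. -/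
def sobNorm (r : ℝ) (p : ℝ≥0∞) (g : ℝ → Vec n) : ℝ :=
  supN r g + (eLpNorm (deriv g) p (volume.restrict (Ioo (-r) 0))).toReal

/-- The Hölder exponent `1 - 1/p`, with the convention `1/∞ = 0`. -/
def hexp (p : ℝ≥0∞) : ℝ := 1 - (p.toReal)⁻¹

/-! ### Sup norm -/

lemma bdd_img {r : ℝ} {g : ℝ → Vec n} (hg : MemC0 r g) :
    BddAbove ((fun s => ‖g s‖) '' Icc (-r) 0) :=
  (isCompact_Icc.image_of_continuousOn (ContinuousOn.norm hg)).bddAbove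

lemma le_supN {r : ℝ} {g : ℝ → Vec n} (hg : MemC0 r g) {s : ℝ} (hs : s ∈ Icc (-r) 0) :
    ‖g s‖ ≤ supN r g :=
  le_csSup (bdd_img hg) ⟨s, hs, rfl⟩

lemma supN_le {r : ℝ} (hr : 0 < r) {g : ℝ → Vec n} {R : ℝ}
    (h : ∀ s ∈ Icc (-r) 0, ‖g s‖ ≤ R) : supN r g ≤ R := by
  refine csSup_le ⟨_, ⟨0, ⟨by linarith, le_rfl⟩, rfl⟩⟩ ?_
  rintro _ ⟨s, hs, rfl⟩
  exact h s hs

/-- Lipschitz estimate in pointwise form. -/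
lemma f_lip {r : ℝ} (hr : 0 < r) {f : (ℝ → Vec n) → Vec n} {L : ℝ → ℝ} (hf : GoodRHS r f L)
    {R e : ℝ} {x y : ℝ → Vec n} (hx : MemC0 r x) (hy : MemC0 r y)
    (hxR : ∀ s ∈ Icc (-r) 0, ‖x s‖ ≤ R) (hyR : ∀ s ∈ Icc (-r) 0, ‖y s‖ ≤ R)
    (he : ∀ s ∈ Icc (-r) 0, ‖x s - y s‖ ≤ e) : ‖f x - f y‖ ≤ L R * e := by
  obtain ⟨_, _, _, hL, h⟩ := hf
  refine (h R x y hx hy (supN_le hr hxR) (supN_le hr hyR)).trans ?_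
  exact mul_le_mul_of_nonneg_left (supN_le hr he) (hL R)

lemma f_bound {r : ℝ} (hr : 0 < r) {f : (ℝ → Vec n) → Vec n} {L : ℝ → ℝ} (hf : GoodRHS r f L)
    {R : ℝ} {x : ℝ → Vec n} (hx : MemC0 r x)
    (hxR : ∀ s ∈ Icc (-r) 0, ‖x s‖ ≤ R) : ‖f x‖ ≤ L R * R := by
  have hR : 0 ≤ R := (norm_nonneg _).trans (hxR 0 ⟨by linarith, le_rfl⟩)
  have := f_lip hr hf (R := R) (e := R) hx (y := 0) continuousOn_const hxR
    (fun s _ => by simpa using hR) (fun s hs => by simpa using hxR s hs)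
  rwa [hf.1, sub_zero] at this

/-! ### Solutions -/

lemma IsSol.cont {r : ℝ} {f : (ℝ → Vec n) → Vec n} {x0 x : ℝ → Vec n} (h : IsSol r f x0 x ⊤) :
    ContinuousOn x (Ici (-r)) :=
  h.1.mono fun t ht => ⟨ht, ENNReal.ofReal_lt_top⟩

lemma IsSol.eq {r : ℝ} {f : (ℝ → Vec n) → Vec n} {x0 x : ℝ → Vec n} (h : IsSol r f x0 x ⊤)
    {t : ℝ} (ht : 0 ≤ t) : x t = x 0 + ∫ s in (0:ℝ)..t, f (seg r x s) :=
  h.2.2 t ht ENNReal.ofReal_lt_top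

lemma seg_memC0 {r : ℝ} {x : ℝ → Vec n} (hx : ContinuousOn x (Ici (-r))) {t : ℝ} (ht : 0 ≤ t) :
    MemC0 r (seg r x t) := by
  refine hx.comp (Continuous.continuousOn (by fun_prop)) ?_
  intro s hs
  simp only [mem_Ici]
  linarith [hs.1]

lemma exists_bound {r : ℝ} {x : ℝ → Vec n} (hx : ContinuousOn x (Ici (-r))) (T : ℝ) :
    ∃ R, 0 ≤ R ∧ ∀ s ∈ Icc (-r) T, ‖x s‖ ≤ R := by
  obtain ⟨C, hC⟩ := isCompact_Icc.exists_bound_of_continuousOn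
    (hx.mono (fun s (hs : s ∈ Icc (-r) T) => hs.1))
  exact ⟨max C 0, le_max_right _ _, fun s hs => (hC s hs).trans (le_max_left _ _)⟩

lemma cont_f {r : ℝ} (hr : 0 < r) {f : (ℝ → Vec n) → Vec n} {L : ℝ → ℝ} (hf : GoodRHS r f L)
    {x : ℝ → Vec n} (hx : ContinuousOn x (Ici (-r))) (T : ℝ) :
    ContinuousOn (fun s => f (seg r x s)) (Icc 0 T) := by
  obtain ⟨R, hR0, hR⟩ := exists_bound hx T
  have huc := isCompact_Icc.uniformContinuousOn_of_continuous
    (hx.mono (fun s (hs : s ∈ Icc (-r) T) => hs.1))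
  rw [Metric.uniformContinuousOn_iff] at huc
  have hL := hf.2.2.2.1 R
  rw [Metric.continuousOn_iff]
  intro b hb ε hε
  obtain ⟨δ, hδ, h⟩ := huc (ε / (L R + 1)) (by positivity)
  refine ⟨δ, hδ, fun a ha hab => ?_⟩
  have mem : ∀ t ∈ Icc 0 T, ∀ s ∈ Icc (-r) 0, t + s ∈ Icc (-r) T := fun t ht s hs =>
    ⟨by linarith [ht.1, hs.1], by linarith [ht.2, hs.2]⟩
  rw [dist_eq_norm]
  have := f_lip hr hf (R := R) (e := ε / (L R + 1)) (seg_memC0 hx ha.1) (seg_memC0 hx hb.1)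
    (fun s hs => hR _ (mem a ha s hs)) (fun s hs => hR _ (mem b hb s hs)) (fun s hs => by
      have := h (a + s) (mem a ha s hs) (b + s) (mem b hb s hs) (by simpa using hab)
      rw [dist_eq_norm] at this
      exact this.le)
  refine this.trans_lt ?_
  rw [mul_div_assoc', div_lt_iff₀ (by positivity)]
  nlinarith

lemma intble_f {r : ℝ} (hr : 0 < r) {f : (ℝ → Vec n) → Vec n} {L : ℝ → ℝ} (hf : GoodRHS r f L)
    {x : ℝ → Vec n} (hx : ContinuousOn x (Ici (-r))) {a b : ℝ} (ha : 0 ≤ a) (hb : 0 ≤ b) :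
    IntervalIntegrable (fun s => f (seg r x s)) volume a b := by
  refine ((cont_f hr hf hx (max a b)).mono ?_).intervalIntegrable
  intro s hs
  exact ⟨(le_min ha hb).trans hs.1, hs.2⟩

/-- Continuous dependence on initial data. -/
lemma cont_dep {r : ℝ} (hr : 0 < r) {f : (ℝ → Vec n) → Vec n} {L : ℝ → ℝ} (hf : GoodRHS r f L)
    {y0 y : ℝ → Vec n} (hy : IsSol r f y0 y ⊤) (T : ℝ) :
    ∃ δ > 0, ∃ M, ∀ x0 x : ℝ → Vec n, IsSol r f x0 x ⊤ →
      (∀ s ∈ Icc (-r) 0, ‖x0 s - y0 s‖ ≤ δ) → ∀ s ∈ Icc (-r) T, ‖x s‖ ≤ M := by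
  obtain ⟨R, hR0, hR⟩ := exists_bound hy.cont T
  have hL := hf.2.2.2.1 (R + 1)
  obtain ⟨K, hK⟩ : ∃ K, K = L (R + 1) + 1 := ⟨_, rfl⟩
  have hK0 : 0 < K := by linarith
  have hexp0 := Real.exp_pos (-(K * T))
  obtain ⟨δ, hδ⟩ : ∃ δ, δ = Real.exp (-(K * |T|)) / 2 := ⟨_, rfl⟩
  have hδ0 : 0 < δ := by rw [hδ]; positivity
  have hsmall : ∀ t ≤ T, 2 * δ * Real.exp (K * t) ≤ 1 := by
    intro t ht
    have : 2 * δ * Real.exp (K * t) = Real.exp (-(K * |T|) + K * t) := by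
      rw [Real.exp_add, hδ]; ring
    rw [this]
    apply Real.exp_le_one_iff.2
    have := mul_le_mul_of_nonneg_left (ht.trans (le_abs_self T)) hK0.le
    linarith
  have hδ1 : δ ≤ 1 := by
    have : Real.exp (-(K * |T|)) ≤ 1 := Real.exp_le_one_iff.2 (by
      have := abs_nonneg T
      nlinarith)
    rw [hδ]; linarith
  refine ⟨δ, hδ0, R + 1 + δ + ‖y 0‖, fun x0 x hx hclose => ?_⟩
  have hinit : ∀ s ∈ Icc (-r) 0, ‖x s - y s‖ ≤ δ := fun s hs => by
    rw [hx.2.1 hs, hy.2.1 hs]; exact hclose s hs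
  -- main claim
  have claim : ∀ t ∈ Icc 0 T, ‖x t - y t‖ < 2 * δ * Real.exp (K * t) := by
    by_contra hcon
    push Not at hcon
    obtain ⟨t0, ht0, hbad⟩ := hcon
    have hsub : Icc 0 T ⊆ Ici (-r) := fun s hs => by
      simp only [mem_Ici]; linarith [hs.1]
    have hclosed : IsClosed {t ∈ Icc 0 T | 2 * δ * Real.exp (K * t) ≤ ‖x t - y t‖} :=
      isClosed_Icc.isClosed_le (Continuous.continuousOn (by fun_prop))
        (((hx.cont.mono hsub).sub (hy.cont.mono hsub)).norm)
    have hcomp := isCompact_Icc.of_isClosed_subset hclosed (fun t ht => ht.1)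
    obtain ⟨τ, ⟨hτ, hτbad⟩, hmin⟩ := hcomp.exists_isLeast ⟨t0, ht0, hbad⟩
    have hbefore : ∀ s, 0 ≤ s → s < τ → ‖x s - y s‖ ≤ 2 * δ * Real.exp (K * s) := by
      intro s hs hsτ
      by_contra hc
      push Not at hc
      exact absurd (hmin ⟨⟨hs, hsτ.le.trans hτ.2⟩, hc.le⟩) (not_le.2 hsτ)
    have hseg : ∀ s, 0 ≤ s → s < τ → ∀ u ∈ Icc (-r) 0,
        ‖x (s + u) - y (s + u)‖ ≤ 2 * δ * Real.exp (K * s) := by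
      intro s hs hsτ u hu
      have hexp1 : 1 ≤ Real.exp (K * s) := Real.one_le_exp (by positivity)
      rcases le_total (s + u) 0 with h | h
      · have := hinit (s + u) ⟨by linarith [hu.1], h⟩
        nlinarith
      · refine (hbefore _ h (by linarith [hu.2])).trans ?_
        have : Real.exp (K * (s + u)) ≤ Real.exp (K * s) :=
          Real.exp_le_exp.2 (mul_le_mul_of_nonneg_left (by linarith [hu.2]) hK0.le)
        nlinarith
    have hfs : ∀ s, 0 ≤ s → s < τ →
        ‖f (seg r x s) - f (seg r y s)‖ ≤ 2 * δ * (Real.exp (K * s) * K) := by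
      intro s hs hsτ
      have hyb : ∀ u ∈ Icc (-r) 0, ‖y (s + u)‖ ≤ R := fun u hu =>
        hR _ ⟨by linarith [hu.1], by linarith [hu.2, hτ.2]⟩
      have h1 := f_lip hr hf (R := R + 1) (e := 2 * δ * Real.exp (K * s))
        (seg_memC0 hx.cont hs) (seg_memC0 hy.cont hs)
        (fun u hu => by
          have h1 := hseg s hs hsτ u hu
          have h2 := hsmall s (hsτ.le.trans hτ.2)
          have h3 := hyb u hu
          have h4 := norm_add_le (x (s + u) - y (s + u)) (y (s + u))
          rw [sub_add_cancel] at h4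
          show ‖x (s + u)‖ ≤ _
          linarith)
        (fun u hu => (hyb u hu).trans (by linarith))
        (fun u hu => hseg s hs hsτ u hu)
      have : 0 < 2 * δ * Real.exp (K * s) := by positivity
      nlinarith
    have hint : ∫ s in (0:ℝ)..τ, 2 * δ * (Real.exp (K * s) * K) =
        2 * δ * Real.exp (K * τ) - 2 * δ * Real.exp (K * 0) := by
      apply intervalIntegral.integral_eq_sub_of_hasDerivAt (f := fun s => 2 * δ * Real.exp (K * s))
      · intro s _
        have h1 : HasDerivAt (fun s : ℝ => K * s) K s := by
          simpa using (hasDerivAt_id s).const_mul K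
        exact (h1.exp).const_mul _
      · exact Continuous.intervalIntegrable (by fun_prop) _ _
    have hnorm : ‖∫ s in (0:ℝ)..τ, (f (seg r x s) - f (seg r y s))‖ ≤
        ∫ s in (0:ℝ)..τ, 2 * δ * (Real.exp (K * s) * K) := by
      apply intervalIntegral.norm_integral_le_of_norm_le hτ.1
      · have hne : ∀ᵐ s : ℝ, s ≠ τ := by simp [ae_iff, measure_singleton]
        filter_upwards [hne] with s hs hsI
        exact hfs s hsI.1.le (lt_of_le_of_ne hsI.2 hs)
      · exact Continuous.intervalIntegrable (by fun_prop) _ _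
    have heq : x τ - y τ = (x 0 - y 0) + ∫ s in (0:ℝ)..τ, (f (seg r x s) - f (seg r y s)) := by
      rw [intervalIntegral.integral_sub (intble_f hr hf hx.cont le_rfl hτ.1)
        (intble_f hr hf hy.cont le_rfl hτ.1), hx.eq hτ.1, hy.eq hτ.1]
      abel
    have h0 := hinit 0 ⟨by linarith, le_rfl⟩
    have h5 := norm_add_le (x 0 - y 0) (∫ s in (0:ℝ)..τ, (f (seg r x s) - f (seg r y s)))
    rw [← heq] at h5
    rw [hint] at hnorm
    simp only [mul_zero, Real.exp_zero, mul_one] at hnorm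
    linarith
  intro s hs
  have h4 := norm_add_le (x s - y s) (y s)
  rw [sub_add_cancel] at h4
  rcases le_total s 0 with h | h
  · have h1 := hinit s ⟨hs.1, h⟩
    have h2 := hR s hs
    have := norm_nonneg (y 0)
    linarith
  · have h1 := claim s ⟨h, hs.2⟩
    have h2 := hR s hs
    have h3 := hsmall s hs.2
    have := norm_nonneg (y 0)
    linarith

/-- Uniform Hölder bound. -/
def HB (r α ρ : ℝ) (g : ℝ → Vec n) : Prop :=
  (∀ s ∈ Icc (-r) 0, ‖g s‖ ≤ ρ) ∧
  ∀ s ∈ Icc (-r) 0, ∀ t ∈ Icc (-r) 0, ‖g s - g t‖ ≤ ρ * |s - t| ^ α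

lemma HB.cont {r α ρ : ℝ} (hα : 0 < α) {g : ℝ → Vec n} (h : HB r α ρ g) : MemC0 r g := by
  intro t ht
  rw [ContinuousWithinAt, tendsto_iff_norm_sub_tendsto_zero]
  have hlim : Tendsto (fun s : ℝ => ρ * |s - t| ^ α) (𝓝[Icc (-r) 0] t) (𝓝 0) := by
    have : Continuous (fun s : ℝ => ρ * |s - t| ^ α) := by
      refine continuous_const.mul (Continuous.rpow_const (by fun_prop) (fun _ => Or.inr hα.le))
    have h2 := (this.tendsto t).mono_left (nhdsWithin_le_nhds (s := Icc (-r) 0))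
    simpa [Real.zero_rpow hα.ne'] using h2
  refine squeeze_zero' (Eventually.of_forall fun _ => norm_nonneg _) ?_ hlim
  filter_upwards [self_mem_nhdsWithin] with s hs
  exact h.2 s hs t ht

lemma HB.memHol {r α ρ : ℝ} (hα : 0 < α) {g : ℝ → Vec n} (h : HB r α ρ g) : MemHol r α g := by
  refine ⟨h.cont hα, ρ, ?_⟩
  rintro c ⟨t, ht, s, hs, hne, rfl⟩
  have : 0 < |t - s| := abs_pos.2 (sub_ne_zero.2 hne)
  rw [div_le_iff₀ (by positivity)]
  exact h.2 t ht s hs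

lemma HB.norm_le {r α ρ : ℝ} (hr : 0 < r) {g : ℝ → Vec n} (h : HB r α ρ g) :
    holderNorm r α g ≤ ρ := by
  refine max_le (supN_le hr h.1) (csSup_le ?_ ?_)
  · exact ⟨_, 0, ⟨by linarith, le_rfl⟩, -r, ⟨le_rfl, by linarith⟩, by linarith, rfl⟩
  · rintro c ⟨t, ht, s, hs, hne, rfl⟩
    have : 0 < |t - s| := abs_pos.2 (sub_ne_zero.2 hne)
    rw [div_le_iff₀ (by positivity)]
    exact h.2 t ht s hs

lemma HB.of_norm_le {r α ρ : ℝ} (hα : 0 < α) {g : ℝ → Vec n} (h : MemHol r α g)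
    (hρ : holderNorm r α g ≤ ρ) : HB r α ρ g := by
  refine ⟨fun s hs => (le_supN h.1 hs).trans ((le_max_left _ _).trans hρ), fun s hs t ht => ?_⟩
  rcases eq_or_ne s t with rfl | hne
  · simp [Real.zero_rpow hα.ne']
  · have hp : 0 < |s - t| := abs_pos.2 (sub_ne_zero.2 hne)
    rw [← div_le_iff₀ (by positivity)]
    exact (le_csSup h.2 ⟨s, hs, t, ht, hne, rfl⟩).trans ((le_max_right _ _).trans hρ)

lemma unif_bound {r : ℝ} (hr : 0 < r) {f : (ℝ → Vec n) → Vec n} {L : ℝ → ℝ}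
    (hf : GoodRHS r f L) {α : ℝ} (hα : 0 < α)
    (hFC : ∀ x0 : ℝ → Vec n, MemHol r α x0 → ∃ x : ℝ → Vec n, IsSol r f x0 x ⊤) (ρ T : ℝ) :
    ∃ R, ∀ x0 x : ℝ → Vec n, HB r α ρ x0 → IsSol r f x0 x ⊤ → ∀ s ∈ Icc (-r) T, ‖x s‖ ≤ R := by
  have hr0 : -r ≤ 0 := by linarith
  let A : Set (BoundedContinuousFunction (Icc (-r) 0) (Vec n)) :=
    {g | (∀ s, ‖g s‖ ≤ ρ) ∧ ∀ s t, ‖g s - g t‖ ≤ ρ * |(s:ℝ) - t| ^ α}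
  have hA : IsCompact A := by
    apply BoundedContinuousFunction.arzela_ascoli₂ (Metric.closedBall 0 ρ)
      (isCompact_closedBall _ _)
    · have : A = (⋂ s : Icc (-r) 0, {g | ‖g s‖ ≤ ρ}) ∩
          ⋂ s : Icc (-r) 0, ⋂ t : Icc (-r) 0, {g | ‖g s - g t‖ ≤ ρ * |(s:ℝ) - t| ^ α} := by
        ext g
        simp only [A, mem_setOf_eq, mem_inter_iff, mem_iInter]
      rw [this]
      refine (isClosed_iInter fun s => ?_).inter
        (isClosed_iInter fun s => isClosed_iInter fun t => ?_)
      · exact isClosed_le (continuous_eval_const _).norm continuous_const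
      · exact isClosed_le ((continuous_eval_const _).sub
          (continuous_eval_const _)).norm continuous_const
    · intro g s hg
      simpa using hg.1 s
    · refine Metric.equicontinuous_of_continuity_modulus (fun d => ρ * |d| ^ α) ?_ _ ?_
      · have : Continuous (fun d : ℝ => ρ * |d| ^ α) := by
          refine continuous_const.mul (Continuous.rpow_const (by fun_prop) (fun _ => Or.inr hα.le))
        simpa [Real.zero_rpow hα.ne'] using this.tendsto 0
      · intro s t g
        rw [dist_eq_norm, Subtype.dist_eq, Real.dist_eq, abs_abs]
        exact g.2.2 s t
  have key : ∃ M, ∀ x0 x : ℝ → Vec n, (∃ g ∈ A, ∀ s : Icc (-r) 0, x0 s = g s) →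
      IsSol r f x0 x ⊤ → ∀ s ∈ Icc (-r) T, ‖x s‖ ≤ M := by
    refine hA.induction_on (p := fun S => ∃ M, ∀ x0 x : ℝ → Vec n,
      (∃ g ∈ S, ∀ s : Icc (-r) 0, x0 s = g s) →
      IsSol r f x0 x ⊤ → ∀ s ∈ Icc (-r) T, ‖x s‖ ≤ M) ?_ ?_ ?_ ?_
    · exact ⟨0, fun x0 x ⟨g, hg, _⟩ => absurd hg (notMem_empty _)⟩
    · rintro S S' hSS ⟨M, hM⟩
      exact ⟨M, fun x0 x ⟨g, hg, h⟩ => hM x0 x ⟨g, hSS hg, h⟩⟩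
    · rintro S S' ⟨M, hM⟩ ⟨M', hM'⟩
      refine ⟨max M M', fun x0 x ⟨g, hg, h⟩ hs s hsI => ?_⟩
      rcases hg with hg | hg
      · exact (hM x0 x ⟨g, hg, h⟩ hs s hsI).trans (le_max_left _ _)
      · exact (hM' x0 x ⟨g, hg, h⟩ hs s hsI).trans (le_max_right _ _)
    · intro g hg
      let y0 : ℝ → Vec n := IccExtend hr0 g
      have hy0 : ∀ s : Icc (-r) 0, y0 s = g s := fun s => IccExtend_val hr0 g s
      have hHB : HB r α ρ y0 := by
        refine ⟨fun s hs => ?_, fun s hs t ht => ?_⟩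
        · rw [hy0 ⟨s, hs⟩]; exact hg.1 _
        · rw [hy0 ⟨s, hs⟩, hy0 ⟨t, ht⟩]; exact hg.2 _ _
      obtain ⟨y, hy⟩ := hFC y0 (hHB.memHol hα)
      obtain ⟨δ, hδ, M, hM⟩ := cont_dep hr hf hy T
      refine ⟨Metric.ball g δ, mem_nhdsWithin_of_mem_nhds (Metric.ball_mem_nhds g hδ), M, ?_⟩
      rintro x0 x ⟨g', hg', h⟩ hx
      refine hM x0 x hx fun s hs => ?_
      rw [h ⟨s, hs⟩, hy0 ⟨s, hs⟩, ← dist_eq_norm]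
      exact (BoundedContinuousFunction.dist_coe_le_dist _).trans (le_of_lt hg')
  obtain ⟨M, hM⟩ := key
  refine ⟨M, fun x0 x h hx => hM x0 x ?_ hx⟩
  refine ⟨BoundedContinuousFunction.mkOfCompact ⟨fun s : Icc (-r) 0 => x0 s, ?_⟩, ⟨?_, ?_⟩, ?_⟩
  · exact continuousOn_iff_continuous_domRestrict.1 (h.cont hα)
  · intro s; exact h.1 s s.2
  · intro s t; exact h.2 s s.2 t t.2
  · intro s; rfl

/-! ### Hölder case -/

lemma sol_lip {r : ℝ} (hr : 0 < r) {f : (ℝ → Vec n) → Vec n} {L : ℝ → ℝ}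
    (hf : GoodRHS r f L) {x0 x : ℝ → Vec n} (hx : IsSol r f x0 x ⊤) {R T : ℝ}
    (hR : ∀ s ∈ Icc (-r) T, ‖x s‖ ≤ R) {a b : ℝ} (ha : a ∈ Icc 0 T) (hb : b ∈ Icc 0 T) :
    ‖x a - x b‖ ≤ L R * R * |a - b| := by
  have heq : x a - x b = ∫ s in b..a, f (seg r x s) := by
    rw [hx.eq ha.1, hx.eq hb.1, ← intervalIntegral.integral_interval_sub_left
      (intble_f hr hf hx.cont le_rfl ha.1) (intble_f hr hf hx.cont le_rfl hb.1)]
    abel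
  rw [heq]
  apply intervalIntegral.norm_integral_le_of_norm_le_const
  intro s hs
  have hs' := uIoc_subset_uIcc hs
  have h0 : 0 ≤ s := (le_min hb.1 ha.1).trans hs'.1
  have hT : s ≤ T := hs'.2.trans (max_le hb.2 ha.2)
  exact f_bound hr hf (seg_memC0 hx.cont h0) fun u hu =>
    hR _ ⟨by linarith [hu.1], by linarith [hu.2]⟩

lemma hol_step {r : ℝ} (hr : 0 < r) {f : (ℝ → Vec n) → Vec n} {L : ℝ → ℝ}
    (hf : GoodRHS r f L) {α : ℝ} (hα : 0 < α) (hα1 : α ≤ 1)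
    {x0 x : ℝ → Vec n} (hx : IsSol r f x0 x ⊤) {ρ R T : ℝ} (h0 : HB r α ρ x0)
    (hR : ∀ s ∈ Icc (-r) T, ‖x s‖ ≤ R) {t : ℝ} (ht : t ∈ Icc 0 T) :
    HB r α (R + ρ + L R * R * r ^ (1 - α)) (seg r x t) := by
  have hL := hf.2.2.2.1 R
  have hR0 : 0 ≤ R := (norm_nonneg _).trans (hR 0 ⟨by linarith, ht.1.trans ht.2⟩)
  have hρ0 : 0 ≤ ρ := (norm_nonneg _).trans (h0.1 0 ⟨by linarith, le_rfl⟩)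
  have hC : 0 ≤ L R * R * r ^ (1 - α) := by positivity
  have mem : ∀ s ∈ Icc (-r) 0, t + s ∈ Icc (-r) T := fun s hs =>
    ⟨by linarith [ht.1, hs.1], by linarith [ht.2, hs.2]⟩
  refine ⟨fun s hs => (hR _ (mem s hs)).trans (by linarith), fun a ha b hb => ?_⟩
  show ‖x (t + a) - x (t + b)‖ ≤ _
  have hdec : ∀ s, x s = x (min s 0) + x (max s 0) - x 0 := by
    intro s
    rcases le_total s 0 with h | h
    · rw [min_eq_left h, max_eq_right h]; abel
    · rw [min_eq_right h, max_eq_left h]; abel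
  have habs : |(t + a) - (t + b)| = |a - b| := by congr 1; ring
  have hmin : ∀ s ∈ Icc (-r) 0, min (t + s) 0 ∈ Icc (-r) 0 := fun s hs =>
    ⟨le_min (mem s hs).1 (by linarith), min_le_right _ _⟩
  have hmax : ∀ s ∈ Icc (-r) 0, max (t + s) 0 ∈ Icc 0 T := fun s hs =>
    ⟨le_max_right _ _, max_le (mem s hs).2 (ht.1.trans ht.2)⟩
  have h1 : ‖x (min (t + a) 0) - x (min (t + b) 0)‖ ≤ ρ * |a - b| ^ α := by
    rw [hx.2.1 (hmin a ha), hx.2.1 (hmin b hb)]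
    refine (h0.2 _ (hmin a ha) _ (hmin b hb)).trans ?_
    refine mul_le_mul_of_nonneg_left ?_ hρ0
    refine Real.rpow_le_rpow (abs_nonneg _) ?_ hα.le
    have := abs_min_sub_min_le_max (t + a) 0 (t + b) 0
    rw [habs] at this
    simpa using this
  have h2 : ‖x (max (t + a) 0) - x (max (t + b) 0)‖ ≤ L R * R * r ^ (1 - α) * |a - b| ^ α := by
    refine (sol_lip hr hf hx hR (hmax a ha) (hmax b hb)).trans ?_
    rw [mul_assoc (L R * R)]
    refine mul_le_mul_of_nonneg_left ?_ (by positivity)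
    have h3 := abs_max_sub_max_le_max (t + a) 0 (t + b) 0
    rw [habs] at h3
    have h4 : |max (t + a) 0 - max (t + b) 0| ≤ |a - b| := by simpa using h3
    refine h4.trans ?_
    rcases eq_or_ne a b with rfl | hne
    · simp [Real.zero_rpow hα.ne']
    have hp : 0 < |a - b| := abs_pos.2 (sub_ne_zero.2 hne)
    have h5 : |a - b| ≤ r := by
      rw [abs_le]; constructor <;> linarith [ha.1, ha.2, hb.1, hb.2]
    calc |a - b| = |a - b| ^ (1 - α) * |a - b| ^ α := by
          rw [← Real.rpow_add hp]; simp
      _ ≤ r ^ (1 - α) * |a - b| ^ α := by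
          gcongr
  have h6 : x (t + a) - x (t + b) = (x (min (t + a) 0) - x (min (t + b) 0)) +
      (x (max (t + a) 0) - x (max (t + b) 0)) := by
    rw [hdec (t + a), hdec (t + b)]; abel
  rw [h6]
  refine (norm_add_le _ _).trans ?_
  have h7 : 0 ≤ R * |a - b| ^ α := by positivity
  linarith

/-! ### Sobolev case -/

lemma deriv_ae {r : ℝ} (hr : 0 < r) {g d : ℝ → Vec n} (hd : IntegrableOn d (Icc (-r) 0))
    (hg : ∀ t ∈ Icc (-r) 0, g t = g (-r) + ∫ s in (-r)..t, d s) :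
    deriv g =ᵐ[volume.restrict (Ioo (-r) 0)] d := by
  have hr0 : -r ≤ 0 := by linarith
  have hi : IntervalIntegrable d volume (-r) 0 :=
    (intervalIntegrable_iff_integrableOn_Icc_of_le hr0).2 hd
  rw [Filter.EventuallyEq, ae_restrict_iff' measurableSet_Ioo]
  filter_upwards [hi.ae_hasDerivAt_integral] with t ht htI
  rw [uIcc_of_le hr0] at ht
  have h1 := (ht (Ioo_subset_Icc_self htI) (-r) ⟨le_rfl, hr0⟩).const_add (g (-r))
  have h2 : g =ᶠ[𝓝 t] fun u => g (-r) + ∫ s in (-r)..u, d s := by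
    filter_upwards [Ioo_mem_nhds htI.1 htI.2] with u hu
    exact hg u (Ioo_subset_Icc_self hu)
  exact (h1.congr_of_eventuallyEq h2).deriv

lemma hexp_pos {p : ℝ≥0∞} (hp : 1 < p) : 0 < hexp p := by
  unfold hexp
  rcases eq_or_ne p ⊤ with rfl | h
  · simp
  · have : 1 < p.toReal := by
      rw [← ENNReal.toReal_one]
      exact (ENNReal.toReal_lt_toReal (by simp) h).2 hp
    have := inv_lt_one_of_one_lt₀ this
    linarith

lemma hexp_le_one (p : ℝ≥0∞) : hexp p ≤ 1 := by
  unfold hexp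
  have : 0 ≤ (p.toReal)⁻¹ := by positivity
  linarith

lemma MemW.memC0 {r : ℝ} (hr : 0 < r) {p : ℝ≥0∞} {g : ℝ → Vec n} (h : MemW r p g) :
    MemC0 r g := by
  obtain ⟨d, hd, _, hg⟩ := h
  have : ContinuousOn (fun t => g (-r) + ∫ s in (-r)..t, d s) (Icc (-r) 0) := by
    refine continuousOn_const.add ?_
    have h1 := intervalIntegral.continuousOn_primitive_interval (a := -r) (b := 0) (f := d)
      (μ := volume)
    rw [uIcc_of_le (by linarith)] at h1
    exact h1 hd
  exact this.congr hg

lemma MemW.HB {r : ℝ} (hr : 0 < r) {p : ℝ≥0∞} (hp : 1 < p) {g : ℝ → Vec n} {ρ : ℝ}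
    (h : MemW r p g) (hρ : sobNorm r p g ≤ ρ) : HB r (hexp p) ρ g := by
  have hc := h.memC0 hr
  obtain ⟨d, hd, hfin, hg⟩ := h
  have hnorm : eLpNorm (deriv g) p (volume.restrict (Ioo (-r) 0)) =
      eLpNorm d p (volume.restrict (Ioo (-r) 0)) := eLpNorm_congr_ae (deriv_ae hr hd hg)
  unfold sobNorm at hρ
  rw [hnorm] at hρ
  set N := eLpNorm d p (volume.restrict (Ioo (-r) 0)) with hN
  have hsup0 : 0 ≤ supN r g :=
    (norm_nonneg _).trans (le_supN hc (s := 0) ⟨by linarith, le_rfl⟩)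
  refine ⟨fun s hs => (le_supN hc hs).trans (by linarith [ENNReal.toReal_nonneg (a := N)]), ?_⟩
  have hα := hexp_pos hp
  have main : ∀ s ∈ Icc (-r) 0, ∀ t ∈ Icc (-r) 0, s ≤ t →
      ‖g t - g s‖ ≤ ρ * |t - s| ^ (hexp p) := by
    intro s hs t ht hst
    have hi : ∀ u ∈ Icc (-r) 0, IntervalIntegrable d volume (-r) u := fun u hu =>
      (intervalIntegrable_iff_integrableOn_Icc_of_le hu.1).2
        (hd.mono_set (Icc_subset_Icc le_rfl hu.2))
    have heq : g t - g s = ∫ u in Ioc s t, d u := by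
      rw [hg t ht, hg s hs, ← intervalIntegral.integral_of_le hst,
        ← intervalIntegral.integral_interval_sub_left (hi t ht) (hi s hs)]
      abel
    have hmeas : AEStronglyMeasurable d (volume.restrict (Ioc s t)) :=
      (hd.mono_set (Ioc_subset_Icc_self.trans (Icc_subset_Icc hs.1 ht.2))).aestronglyMeasurable
    have hle : ‖g t - g s‖ₑ ≤ N * ENNReal.ofReal (t - s) ^ (hexp p) := by
      rw [heq]
      refine (enorm_integral_le_lintegral_enorm _).trans ?_
      rw [← eLpNorm_one_eq_lintegral_enorm]
      refine (eLpNorm_le_eLpNorm_mul_rpow_measure_univ hp.le hmeas).trans ?_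
      have e1 : (1 / (1:ℝ≥0∞).toReal - 1 / p.toReal) = hexp p := by simp [hexp]
      rw [e1, Measure.restrict_apply_univ, Real.volume_Ioc]
      gcongr
      rw [hN, Measure.restrict_congr_set (Ioo_ae_eq_Ioc (a := -r) (b := 0))]
      exact eLpNorm_mono_measure _ (Measure.restrict_mono (Ioc_subset_Ioc hs.1 ht.2) le_rfl)
    have hN' : N = ENNReal.ofReal N.toReal := (ENNReal.ofReal_toReal hfin.ne).symm
    rw [hN', ENNReal.ofReal_rpow_of_nonneg (by linarith) hα.le,
      ← ENNReal.ofReal_mul ENNReal.toReal_nonneg, ← ofReal_norm,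
      ENNReal.ofReal_le_ofReal_iff (by
        have : 0 ≤ t - s := by linarith
        positivity)] at hle
    rw [abs_of_nonneg (by linarith : 0 ≤ t - s)]
    refine hle.trans (mul_le_mul_of_nonneg_right (by linarith) ?_)
    have : 0 ≤ t - s := by linarith
    positivity
  intro s hs t ht
  rcases le_total s t with hst | hst
  · rw [norm_sub_rev, abs_sub_comm]; exact main s hs t ht hst
  · exact main t ht s hs hst

lemma sob_step {r : ℝ} (hr : 0 < r) {f : (ℝ → Vec n) → Vec n} {L : ℝ → ℝ}
    (hf : GoodRHS r f L) {p : ℝ≥0∞} (hp : 1 < p)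
    {x0 x : ℝ → Vec n} (hx : IsSol r f x0 x ⊤) (h0 : MemW r p x0) {ρ R T : ℝ}
    (hρ : sobNorm r p x0 ≤ ρ)
    (hR : ∀ s ∈ Icc (-r) T, ‖x s‖ ≤ R) {t : ℝ} (ht : t ∈ Icc 0 T) :
    MemW r p (seg r x t) ∧ sobNorm r p (seg r x t) ≤
      R + (ρ + (eLpNorm (fun _ : ℝ => L R * R) p (volume.restrict (Ioo (-r) 0))).toReal) := by
  have hc := h0.memC0 hr
  obtain ⟨d, hd, hfin, hg⟩ := h0
  have hr0 : -r ≤ 0 := by linarith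
  have hL := hf.2.2.2.1 R
  have hR0 : 0 ≤ R := (norm_nonneg _).trans (hR 0 ⟨hr0, ht.1.trans ht.2⟩)
  have hK0 : 0 ≤ L R * R := by positivity
  have hnorm0 : eLpNorm (deriv x0) p (volume.restrict (Ioo (-r) 0)) =
      eLpNorm d p (volume.restrict (Ioo (-r) 0)) := eLpNorm_congr_ae (deriv_ae hr hd hg)
  have hsup0 : 0 ≤ supN r x0 :=
    (norm_nonneg _).trans (le_supN hc (s := 0) ⟨by linarith, le_rfl⟩)
  unfold sobNorm at hρ
  rw [hnorm0] at hρ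
  let D : ℝ → Vec n := fun u => if u ≤ 0 then d u else f (seg r x u)
  have hD1 : ∀ u ∈ Icc (-r) 0, IntervalIntegrable D volume (-r) u ∧
      ∫ s in (-r)..u, D s = ∫ s in (-r)..u, d s := by
    intro u hu
    have hi : IntervalIntegrable d volume (-r) u :=
      (intervalIntegrable_iff_integrableOn_Icc_of_le hu.1).2
        (hd.mono_set (Icc_subset_Icc le_rfl hu.2))
    have he : EqOn d D (uIoc (-r) u) := by
      intro s hs
      rw [uIoc_of_le hu.1] at hs
      simp [D, hs.2.trans hu.2]
    exact ⟨hi.congr he, intervalIntegral.integral_congr_ae (Eventually.of_forall fun s hs => (he hs).symm)⟩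
  have hD2 : ∀ u, 0 ≤ u → IntervalIntegrable D volume 0 u ∧
      ∫ s in (0:ℝ)..u, D s = ∫ s in (0:ℝ)..u, f (seg r x s) := by
    intro u hu
    have he : EqOn (fun s => f (seg r x s)) D (uIoc 0 u) := by
      intro s hs
      rw [uIoc_of_le hu] at hs
      simp [D, not_le.2 hs.1]
    exact ⟨(intble_f hr hf hx.cont le_rfl hu).congr he,
      intervalIntegral.integral_congr_ae (Eventually.of_forall fun s hs => (he hs).symm)⟩
  have hDi : ∀ u, -r ≤ u → IntervalIntegrable D volume (-r) u := by
    intro u hu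
    rcases le_total u 0 with h | h
    · exact (hD1 u ⟨hu, h⟩).1
    · exact (hD1 0 ⟨hr0, le_rfl⟩).1.trans (hD2 u h).1
  have hxD : ∀ u, -r ≤ u → x u = x (-r) + ∫ s in (-r)..u, D s := by
    have hneg : ∀ u ∈ Icc (-r) 0, x u = x (-r) + ∫ s in (-r)..u, D s := by
      intro u hu
      rw [(hD1 u hu).2, hx.2.1 hu, hx.2.1 ⟨le_rfl, hr0⟩]
      exact hg u hu
    intro u hu
    rcases le_total u 0 with h | h
    · exact hneg u ⟨hu, h⟩
    · rw [hx.eq h, ← (hD2 u h).2, hneg 0 ⟨hr0, le_rfl⟩,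
        ← intervalIntegral.integral_add_adjacent_intervals (hD1 0 ⟨hr0, le_rfl⟩).1 (hD2 u h).1]
      abel
  -- the derivative of the segment
  have htr : -r ≤ t + -r := by linarith [ht.1]
  have hDt : IntervalIntegrable D volume (t + -r) (t + 0) :=
    (hDi _ htr).symm.trans (hDi _ (by linarith [ht.1]))
  have hd' : IntegrableOn (fun s => D (t + s)) (Icc (-r) 0) := by
    rw [← intervalIntegrable_iff_integrableOn_Icc_of_le hr0]
    simpa using hDt.comp_add_left t
  have hg' : ∀ u ∈ Icc (-r) 0, seg r x t u = seg r x t (-r) + ∫ s in (-r)..u, D (t + s) := by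
    intro u hu
    have hu' : -r ≤ t + u := by linarith [ht.1, hu.1]
    rw [intervalIntegral.integral_comp_add_left (fun s => D s)]
    show x (t + u) = x (t + -r) + _
    rw [hxD _ hu', hxD _ htr, ← intervalIntegral.integral_interval_sub_left (hDi _ hu') (hDi _ htr)]
    abel
  -- the L^p bound
  let A : ℝ → Vec n := (Ioc (-r) 0).indicator d
  have hAm : AEStronglyMeasurable A volume := by
    rw [aestronglyMeasurable_indicator_iff measurableSet_Ioc]
    exact (hd.mono_set Ioc_subset_Icc_self).aestronglyMeasurable
  have hmp : MeasurePreserving (fun s : ℝ => t + s) volume volume :=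
    measurePreserving_add_left volume t
  have hAm' : AEStronglyMeasurable (fun s => A (t + s)) volume := hAm.comp_measurePreserving hmp
  have hAn : eLpNorm (fun s => A (t + s)) p (volume.restrict (Ioo (-r) 0)) ≤
      eLpNorm d p (volume.restrict (Ioo (-r) 0)) := by
    refine (eLpNorm_mono_measure _ Measure.restrict_le_self).trans ?_
    have h1 := eLpNorm_comp_measurePreserving (p := p) hAm hmp
    have h2 : eLpNorm A p volume = eLpNorm d p (volume.restrict (Ioc (-r) 0)) :=
      eLpNorm_indicator_eq_eLpNorm_restrict measurableSet_Ioc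
    rw [Measure.restrict_congr_set (Ioo_ae_eq_Ioc (a := -r) (b := 0)), ← h2, ← h1]
    rfl
  have hpt : ∀ s ∈ Ioo (-r) 0, ‖D (t + s)‖ ≤ ‖A (t + s)‖ + L R * R := by
    intro s hs
    have hs1 : -r < t + s := by linarith [ht.1, hs.1]
    by_cases h : t + s ≤ 0
    · have hDs : D (t + s) = d (t + s) := if_pos h
      have hAs : A (t + s) = d (t + s) := indicator_of_mem (show t + s ∈ Ioc (-r) 0 from ⟨hs1, h⟩) d
      rw [hDs, hAs]
      linarith
    · have hDs : D (t + s) = f (seg r x (t + s)) := if_neg h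
      rw [hDs]
      push Not at h
      have := f_bound hr hf (R := R) (seg_memC0 hx.cont h.le) fun u hu =>
        hR _ ⟨by linarith [hu.1], by linarith [hu.2, hs.2, ht.2]⟩
      linarith [norm_nonneg (A (t + s))]
  have hle : eLpNorm (fun s => D (t + s)) p (volume.restrict (Ioo (-r) 0)) ≤
      eLpNorm d p (volume.restrict (Ioo (-r) 0)) +
        eLpNorm (fun _ : ℝ => L R * R) p (volume.restrict (Ioo (-r) 0)) := by
    calc eLpNorm (fun s => D (t + s)) p (volume.restrict (Ioo (-r) 0))
        ≤ eLpNorm ((fun s => ‖A (t + s)‖) + fun _ : ℝ => L R * R) p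
            (volume.restrict (Ioo (-r) 0)) := by
          refine eLpNorm_mono_ae_real ?_
          rw [ae_restrict_iff' measurableSet_Ioo]
          exact Eventually.of_forall hpt
      _ ≤ eLpNorm (fun s => ‖A (t + s)‖) p (volume.restrict (Ioo (-r) 0)) +
            eLpNorm (fun _ : ℝ => L R * R) p (volume.restrict (Ioo (-r) 0)) :=
          eLpNorm_add_le hAm'.restrict.norm aestronglyMeasurable_const hp.le
      _ ≤ _ := by
          rw [eLpNorm_norm]
          gcongr
  have hcfin : eLpNorm (fun _ : ℝ => L R * R) p (volume.restrict (Ioo (-r) 0)) < ⊤ :=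
    (memLp_const (L R * R)).eLpNorm_lt_top
  refine ⟨⟨fun s => D (t + s), hd', hle.trans_lt (ENNReal.add_lt_top.2 ⟨hfin, hcfin⟩), hg'⟩, ?_⟩
  unfold sobNorm
  rw [eLpNorm_congr_ae (deriv_ae hr hd' hg')]
  have h1 : supN r (seg r x t) ≤ R := supN_le hr fun s hs =>
    hR _ ⟨by linarith [ht.1, hs.1], by linarith [ht.2, hs.2]⟩
  have h2 := ENNReal.toReal_mono (ENNReal.add_lt_top.2 ⟨hfin, hcfin⟩).ne hle
  rw [ENNReal.toReal_add hfin.ne hcfin.ne] at h2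
  linarith

/-- If the system is forward complete from Hölder `C^{0,1-1/p}`
initial data, then it is robustly forward complete when the state space `X` is
`W^{1,p}` or `C^{0,1-1/p}` (`p ∈ (1,∞]`): segments stay in `X` and reachable sets
from bounded sets of `X` on finite horizons are bounded in `X`. -/
theorem stmt2 (n : ℕ) (hn : 1 ≤ n) (r : ℝ) (hr : 0 < r)
    (f : (ℝ → Vec n) → Vec n) (L : ℝ → ℝ) (hf : GoodRHS r f L)
    (p : ℝ≥0∞) (hp : 1 < p)
    (hFC : ∀ x0 : ℝ → Vec n, MemHol r (hexp p) x0 → ∃ x : ℝ → Vec n, IsSol r f x0 x ⊤)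
    (MemX : (ℝ → Vec n) → Prop) (NormX : (ℝ → Vec n) → ℝ)
    (hX : (MemX = MemW r p ∧ NormX = sobNorm r p) ∨
          (MemX = MemHol r (hexp p) ∧ NormX = holderNorm r (hexp p))) :
    (∀ x0 x : ℝ → Vec n, MemX x0 → IsSol r f x0 x ⊤ → ∀ t : ℝ, 0 ≤ t →
        MemX (seg r x t)) ∧
    (∀ ρ T : ℝ, 0 < ρ → 0 < T → ∃ M : ℝ, ∀ x0 x : ℝ → Vec n, MemX x0 →
        IsSol r f x0 x ⊤ → NormX x0 ≤ ρ → ∀ t ∈ Icc (0:ℝ) T, NormX (seg r x t) ≤ M) := by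
  have hα := hexp_pos hp
  have hα1 := hexp_le_one p
  rcases hX with ⟨rfl, rfl⟩ | ⟨rfl, rfl⟩
  · refine ⟨fun x0 x h0 hx t ht => ?_, fun ρ T _ _ => ?_⟩
    · obtain ⟨R, _, hR⟩ := exists_bound hx.cont t
      exact (sob_step hr hf hp hx h0 le_rfl hR ⟨ht, le_rfl⟩).1
    · obtain ⟨R, hR⟩ := unif_bound hr hf hα hFC ρ T
      exact ⟨_, fun x0 x h0 hx hρ t ht =>
        (sob_step hr hf hp hx h0 hρ (hR x0 x (h0.HB hr hp hρ) hx) ht).2⟩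
  · refine ⟨fun x0 x h0 hx t ht => ?_, fun ρ T _ _ => ?_⟩
    · obtain ⟨R, _, hR⟩ := exists_bound hx.cont t
      exact (hol_step hr hf hα hα1 hx (HB.of_norm_le hα h0 le_rfl) hR ⟨ht, le_rfl⟩).memHol hα
    · obtain ⟨R, hR⟩ := unif_bound hr hf hα hFC ρ T
      exact ⟨_, fun x0 x h0 hx hρ t ht =>
        (hol_step hr hf hα hα1 hx (HB.of_norm_le hα h0 hρ)
          (hR x0 x (HB.of_norm_le hα h0 hρ) hx) ht).norm_le hr⟩
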